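/- Let F : C ⇄ D : U be a monadic adjunction such that C is κ-presentable, D has all small colimits, and U preserves κ-filtered colimits. Then D is κ-presentable. -/

import Mathlib

/-!
STATEMENT 11: A monadic adjunction `F ⊣ U` with `C` κ-presentable, `D` cocomplete
and `U` preserving κ-filtered colimits implies that `D` is κ-presentable.
-/

open CategoryTheory CategoryTheory.Limits

universe w v u v' u'

/-- A category `J` is `κ`-filtered if every diagram indexed by a category with fewer
than `κ` morphisms admits a cocone. -/
def IsCardinalFiltered (κ : Cardinal.{w}) (J : Cat.{w, w}) : Prop :=
  ∀ A : Cat.{w, w}, Cardinal.mk (Σ (a : A) (b : A), a ⟶ b) < κ →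
    ∀ F : A ⥤ J, Nonempty (Cocone F)

/-- An object `X` is `κ`-compact if `Map(X, -)` preserves `κ`-filtered colimits. -/
def IsCardinalCompact (κ : Cardinal.{w}) {C : Type u} [Category.{v} C] (X : C) : Prop :=
  ∀ J : Cat.{w, w}, IsCardinalFiltered κ J →
    Nonempty (PreservesColimitsOfShape J (coyoneda.obj (Opposite.op X)))

/-- A category is `κ`-accessible if it has `κ`-filtered colimits, every object is a
`κ`-filtered colimit of `κ`-compact objects, and the `κ`-compact objects form an
essentially small subcategory. -/
def IsCardinalAccessible (κ : Cardinal.{w}) (C : Type u) [Category.{v} C] : Prop :=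
  (∀ J : Cat.{w, w}, IsCardinalFiltered κ J → HasColimitsOfShape J C) ∧
  (∀ X : C, ∃ (J : Cat.{w, w}) (F : J ⥤ C) (c : Cocone F),
      Nonempty (IsColimit c) ∧ IsCardinalFiltered κ J ∧
      (∀ j : J, IsCardinalCompact κ (F.obj j)) ∧ Nonempty (c.pt ≅ X)) ∧
  (∃ (ι : Type w) (G : ι → C), (∀ i, IsCardinalCompact κ (G i)) ∧
      ∀ X : C, IsCardinalCompact κ X → ∃ i, Nonempty (X ≅ G i))

/-- A category is `κ`-presentable if it is cocomplete and `κ`-accessible. -/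
def IsCardinalPresentable (κ : Cardinal.{w}) (C : Type u) [Category.{v} C] : Prop :=
  HasColimits C ∧ IsCardinalAccessible κ C

namespace CategoryTheory

open Opposite

section Comparison

variable {κ : Cardinal.{w}} [Fact κ.IsRegular]

lemma rootIsCardinalFiltered_iff (J : Cat.{w, w}) :
    _root_.IsCardinalFiltered κ J ↔ CategoryTheory.IsCardinalFiltered J κ := by
  have key (A : Type w) [SmallCategory A] :
      HasCardinalLT (Arrow A) κ ↔ Cardinal.mk (Σ (a : A) (b : A), a ⟶ b) < κ := by
    rw [← hasCardinalLT_iff_cardinal_mk_lt]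
    exact hasCardinalLT_iff_of_equiv
      { toFun f := ⟨f.left, f.right, f.hom⟩
        invFun f := Arrow.mk f.2.2
        left_inv _ := rfl
        right_inv _ := rfl } κ
  exact ⟨fun h ↦ ⟨fun {A} _ F hA ↦ h (Cat.of A) ((key A).1 hA) F⟩,
    fun h A hA F ↦ h.nonempty_cocone F ((key A).2 hA)⟩

lemma rootIsCardinalCompact_iff {C : Type u} [Category.{v} C] (X : C) :
    IsCardinalCompact κ X ↔ CategoryTheory.IsCardinalPresentable X κ :=
  ⟨fun h ↦ ⟨fun J _ _ ↦ (h (Cat.of J) ((rootIsCardinalFiltered_iff _).2 ‹_›)).some⟩,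
    fun h J hJ ↦ by
      have := (rootIsCardinalFiltered_iff J).1 hJ
      exact ⟨h.preservesColimitOfShape J⟩⟩

end Comparison

/-- A lift of a pair of morphisms `p, q` between the points of two cocones to a pair of morphisms
between objects of the corresponding diagrams. -/
structure LiftedPair {D : Type u} [Category.{v} D] {I J : Type w} [SmallCategory I]
    [SmallCategory J] {A : I ⥤ D} {B : J ⥤ D} {a : Cocone A} {b : Cocone B}
    (p q : a.pt ⟶ b.pt) where
  /-- the index of the source -/
  i : I
  /-- the index of the target -/
  j : J
  /-- the lift of `p` -/
  f : A.obj i ⟶ B.obj j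
  /-- the lift of `q` -/
  g : A.obj i ⟶ B.obj j
  hf : f ≫ b.ι.app j = a.ι.app i ≫ p
  hg : g ≫ b.ι.app j = a.ι.app i ≫ q

namespace LiftedPair

variable {D : Type u} [Category.{v} D] {I J : Type w} [SmallCategory I]
    [SmallCategory J] {A : I ⥤ D} {B : J ⥤ D} {a : Cocone A} {b : Cocone B}
    {p q : a.pt ⟶ b.pt}

/-- Morphisms of lifted pairs: maps `u` and `v` on the indices of the sources and of the targets
that are compatible with the lifts. -/
@[ext]
structure Hom (k k' : LiftedPair p q) where
  u : k.i ⟶ k'.i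
  v : k.j ⟶ k'.j
  hf : A.map u ≫ k'.f = k.f ≫ B.map v
  hg : A.map u ≫ k'.g = k.g ≫ B.map v

@[simps id_u id_v comp_u comp_v]
instance : Category (LiftedPair p q) where
  Hom := Hom
  id k := ⟨𝟙 _, 𝟙 _, by simp, by simp⟩
  comp φ ψ := ⟨φ.u ≫ ψ.u, φ.v ≫ ψ.v, by simp [ψ.hf, reassoc_of% φ.hf],
    by simp [ψ.hg, reassoc_of% φ.hg]⟩

@[ext]
lemma hom_ext {k k' : LiftedPair p q} {φ ψ : k ⟶ k'} (hu : φ.u = ψ.u) (hv : φ.v = ψ.v) :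
    φ = ψ :=
  Hom.ext hu hv

variable (p q) in
/-- The projection to the index category of the sources. -/
@[simps]
def source : LiftedPair p q ⥤ I where
  obj k := k.i
  map φ := φ.u

variable (p q) in
/-- The projection to the index category of the targets. -/
@[simps]
def target : LiftedPair p q ⥤ J where
  obj k := k.j
  map φ := φ.v

instance [LocallySmall.{w} D] : EssentiallySmall.{w} (LiftedPair p q) := by
  have : Small.{w} (LiftedPair p q) := by
    refine small_of_injective (β := Σ (i : I) (j : J),
      Shrink.{w} (A.obj i ⟶ B.obj j) × Shrink.{w} (A.obj i ⟶ B.obj j))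
      (f := fun k ↦ ⟨k.i, k.j, equivShrink _ k.f, equivShrink _ k.g⟩) ?_
    rintro ⟨i, j, f, g, _, _⟩ ⟨i', j', f', g', _, _⟩ h
    obtain rfl : i = i' := congr_arg Sigma.fst h
    simp only [Sigma.mk.injEq, heq_eq_eq, true_and] at h
    obtain rfl : j = j' := h.1
    simp only [heq_eq_eq, true_and, Prod.mk.injEq, EmbeddingLike.apply_eq_iff_eq] at h
    obtain ⟨rfl, rfl⟩ := h
    rfl
  have : LocallySmall.{w} (LiftedPair p q) := ⟨fun k k' ↦
    small_of_injective (β := (k.i ⟶ k'.i) × (k.j ⟶ k'.j)) (f := fun φ ↦ (φ.u, φ.v))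
      fun φ ψ h ↦ hom_ext (Prod.ext_iff.1 h).1 (Prod.ext_iff.1 h).2⟩
  exact essentiallySmall_of_small_of_locallySmall _

section Filtered

variable (κ : Cardinal.{w}) [Fact κ.IsRegular] [IsCardinalFiltered J κ]
  [∀ i, IsCardinalPresentable (A.obj i) κ]

include κ in
/-- Fewer than `κ` lifted pairs mapping to given indices all map to a lifted pair
over these indices, up to enlarging the index of the target. -/
lemma exists_bound (hb : IsColimit b) {S : Type*} (hS : HasCardinalLT S κ)
    (k : S → LiftedPair p q) {i : I} {j : J} (u : ∀ s, (k s).i ⟶ i) (v : ∀ s, (k s).j ⟶ j) :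
    ∃ (k' : LiftedPair p q) (hi : k'.i = i) (t : j ⟶ k'.j) (φ : ∀ s, k s ⟶ k'),
      ∀ s, (φ s).u = u s ≫ eqToHom hi.symm ∧ (φ s).v = v s ≫ t := by
  have := isFiltered_of_isCardinalFiltered J κ
  obtain ⟨j₁, f₁, hf₁⟩ := IsCardinalPresentable.exists_hom_of_isColimit κ hb (a.ι.app i ≫ p)
  obtain ⟨j₂, g₂, hg₂⟩ := IsCardinalPresentable.exists_hom_of_isColimit κ hb (a.ι.app i ≫ q)
  obtain ⟨j₀, t₁, t₂, t, -⟩ : ∃ (j₀ : J) (_ : j₁ ⟶ j₀) (_ : j₂ ⟶ j₀) (_ : j ⟶ j₀), True :=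
    ⟨IsFiltered.max₃ j₁ j₂ j, IsFiltered.firstToMax₃ _ _ _, IsFiltered.secondToMax₃ _ _ _,
      IsFiltered.thirdToMax₃ _ _ _, trivial⟩
  have hex (s : S) : ∃ (j' : J) (r : j₀ ⟶ j'),
      A.map (u s) ≫ f₁ ≫ B.map (t₁ ≫ r) = (k s).f ≫ B.map (v s ≫ t ≫ r) ∧
      A.map (u s) ≫ g₂ ≫ B.map (t₂ ≫ r) = (k s).g ≫ B.map (v s ≫ t ≫ r) := by
    obtain ⟨j₃, r, hr⟩ := IsCardinalPresentable.exists_eq_of_isColimit' κ hb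
      (A.map (u s) ≫ f₁ ≫ B.map t₁) ((k s).f ≫ B.map (v s ≫ t)) (by simp [hf₁, (k s).hf])
    obtain ⟨j₄, r', hr'⟩ := IsCardinalPresentable.exists_eq_of_isColimit' κ hb
      (A.map (u s) ≫ g₂ ≫ B.map (t₂ ≫ r)) ((k s).g ≫ B.map (v s ≫ t ≫ r))
      (by simp [hg₂, (k s).hg])
    refine ⟨j₄, r ≫ r', ?_, ?_⟩
    · simpa using congr($hr ≫ B.map r')
    · simpa using hr'
  choose j' r hr hr' using hex
  obtain ⟨m, c, d, hd⟩ := IsCardinalFiltered.wideSpan r hS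
  refine ⟨⟨i, m, f₁ ≫ B.map (t₁ ≫ d), g₂ ≫ B.map (t₂ ≫ d), by simp [hf₁], by simp [hg₂]⟩,
    rfl, t ≫ d, fun s ↦ ⟨u s, v s ≫ t ≫ d, ?_, ?_⟩, fun s ↦ ⟨by simp, rfl⟩⟩
  · simpa [← Functor.map_comp, hd] using congr($(hr s) ≫ B.map (c s))
  · simpa [← Functor.map_comp, hd] using congr($(hr' s) ≫ B.map (c s))

include κ in
lemma isCardinalFiltered [IsCardinalFiltered I κ] (hb : IsColimit b) :
    IsCardinalFiltered (LiftedPair p q) κ where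
  nonempty_cocone {S} _ F hS := by
    obtain ⟨i, u, hu⟩ : ∃ (i : I) (u : ∀ s, (F.obj s).i ⟶ i),
        ∀ {s s'} (x : s ⟶ s'), (F.map x).u ≫ u s' = u s :=
      let c := IsCardinalFiltered.cocone (F ⋙ source p q) hS
      ⟨c.pt, c.ι.app, fun x ↦ c.w x⟩
    obtain ⟨j, v, hv⟩ : ∃ (j : J) (v : ∀ s, (F.obj s).j ⟶ j),
        ∀ {s s'} (x : s ⟶ s'), (F.map x).v ≫ v s' = v s :=
      let c := IsCardinalFiltered.cocone (F ⋙ target p q) hS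
      ⟨c.pt, c.ι.app, fun x ↦ c.w x⟩
    obtain ⟨k, hi, t, φ, hφ⟩ := exists_bound κ hb (hasCardinalLT_of_hasCardinalLT_arrow hS)
      F.obj u v
    refine ⟨k, φ, fun s s' x ↦ ?_⟩
    ext
    · simp [hφ, reassoc_of% hu x]
    · simp [hφ, reassoc_of% hv x]

lemma final_source [IsCardinalFiltered I κ] (hb : IsColimit b) : (source p q).Final := by
  have := isCardinalFiltered (p := p) (q := q) κ hb
  have := isFiltered_of_isCardinalFiltered (LiftedPair p q) κ
  have hκ : Cardinal.aleph0 ≤ κ := (Fact.out : κ.IsRegular).aleph0_le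
  have := isFiltered_of_isCardinalFiltered I κ
  refine Functor.final_of_exists_of_isFiltered _ (fun i ↦ ?_) (fun {i k} s s' ↦ ?_)
  · have := IsCardinalFiltered.nonempty J κ
    obtain ⟨k, hi, -⟩ := exists_bound (p := p) (q := q) κ hb (S := Empty)
      (hasCardinalLT_of_finite _ _ hκ) nofun (i := i) (j := Classical.arbitrary J) nofun nofun
    exact ⟨k, ⟨eqToHom hi.symm⟩⟩
  · obtain ⟨k', hi, t, φ, hφ⟩ := exists_bound κ hb (S := Unit)
      (hasCardinalLT_of_finite _ _ hκ) (fun _ ↦ k) (fun _ ↦ IsFiltered.coeqHom (C := I) s s')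
      (fun _ ↦ 𝟙 _)
    refine ⟨k', φ ⟨⟩, ?_⟩
    change s ≫ (φ ⟨⟩).u = s' ≫ (φ ⟨⟩).u
    rw [(hφ _).1]
    exact IsFiltered.coeq_condition_assoc (C := I) s s' _

lemma final_target [IsCardinalFiltered I κ] (hb : IsColimit b) : (target p q).Final := by
  have := isCardinalFiltered (p := p) (q := q) κ hb
  have := isFiltered_of_isCardinalFiltered (LiftedPair p q) κ
  have hκ : Cardinal.aleph0 ≤ κ := (Fact.out : κ.IsRegular).aleph0_le
  have := isFiltered_of_isCardinalFiltered J κ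
  refine Functor.final_of_exists_of_isFiltered _ (fun j ↦ ?_) (fun {j k} s s' ↦ ?_)
  · have := IsCardinalFiltered.nonempty I κ
    obtain ⟨k, -, t, -⟩ := exists_bound (p := p) (q := q) κ hb (S := Empty)
      (hasCardinalLT_of_finite _ _ hκ) nofun (i := Classical.arbitrary I) (j := j) nofun nofun
    exact ⟨k, ⟨t⟩⟩
  · obtain ⟨k', hi, t, φ, hφ⟩ := exists_bound κ hb (S := Unit)
      (hasCardinalLT_of_finite _ _ hκ) (fun _ ↦ k) (fun _ ↦ 𝟙 _)
      (fun _ ↦ IsFiltered.coeqHom (C := J) s s')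
    refine ⟨k', φ ⟨⟩, ?_⟩
    change s ≫ (φ ⟨⟩).v = s' ≫ (φ ⟨⟩).v
    rw [(hφ _).2]
    exact IsFiltered.coeq_condition_assoc (C := J) s s' _

end Filtered

section Coequalizer

variable [HasCoequalizers D]

variable (p q) in
/-- The functor sending a lifted pair to its coequalizer. -/
noncomputable def coequalizerFunctor : LiftedPair p q ⥤ D where
  obj k := coequalizer k.f k.g
  map {k k'} φ := coequalizer.desc (B.map φ.v ≫ coequalizer.π _ _) (by
    rw [← reassoc_of% φ.hf, ← reassoc_of% φ.hg, coequalizer.condition])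

/-- The projection to the coequalizer of a lifted pair. -/
noncomputable def coequalizerπ (k : LiftedPair p q) :
    B.obj k.j ⟶ (coequalizerFunctor p q).obj k :=
  coequalizer.π k.f k.g

instance (k : LiftedPair p q) : Epi k.coequalizerπ :=
  inferInstanceAs (Epi (coequalizer.π k.f k.g))

lemma coequalizerπ_condition (k : LiftedPair p q) :
    k.f ≫ k.coequalizerπ = k.g ≫ k.coequalizerπ :=
  coequalizer.condition _ _

lemma coequalizerπ_map {k k' : LiftedPair p q} (φ : k ⟶ k') :
    k.coequalizerπ ≫ (coequalizerFunctor p q).map φ = B.map φ.v ≫ k'.coequalizerπ :=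
  coequalizer.π_desc _ _

/-- The map from the coequalizer of a lifted pair to a cofork of `p` and `q`. -/
noncomputable def coequalizerDesc (c : Cofork p q) (k : LiftedPair p q) :
    (coequalizerFunctor p q).obj k ⟶ c.pt :=
  coequalizer.desc (b.ι.app k.j ≫ c.π) (by rw [reassoc_of% k.hf, reassoc_of% k.hg, c.condition])

lemma coequalizerπ_desc (c : Cofork p q) (k : LiftedPair p q) :
    k.coequalizerπ ≫ k.coequalizerDesc c = b.ι.app k.j ≫ c.π :=
  coequalizer.π_desc _ _

/-- The cocone on `coequalizerFunctor p q` whose point is that of a cofork of `p` and `q`. -/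
noncomputable def coequalizerι (c : Cofork p q) :
    coequalizerFunctor p q ⟶ (Functor.const _).obj c.pt where
  app k := k.coequalizerDesc c
  naturality k k' φ := by
    have hb : B.map φ.v ≫ b.ι.app k'.j = b.ι.app k.j := b.w _
    rw [← cancel_epi k.coequalizerπ, reassoc_of% coequalizerπ_map φ, coequalizerπ_desc,
      reassoc_of% hb]
    exact (coequalizerπ_desc c k).symm.trans (congr_arg _ (Category.comp_id _).symm)

/-- A coequalizer of a pair of morphisms between colimits is the colimit of the coequalizers
of the lifted pairs. -/
noncomputable def isColimitCoequalizerι [(source p q).Final] [(target p q).Final]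
    (ha : IsColimit a) (hb : IsColimit b) {c : Cofork p q} (hc : IsColimit c) :
    IsColimit (Cocone.mk c.pt (coequalizerι c)) := by
  let ha' := (Functor.Final.isColimitWhiskerEquiv (source p q) a).symm ha
  let hb' := (Functor.Final.isColimitWhiskerEquiv (target p q) b).symm hb
  let desc₀ (s : Cocone (coequalizerFunctor p q)) : b.pt ⟶ s.pt := hb'.desc
    { pt := s.pt
      ι :=
        { app k := k.coequalizerπ ≫ s.ι.app k
          naturality k k' φ := by
            have := (reassoc_of% coequalizerπ_map φ) (s.ι.app k')
            exact this.symm.trans ((k.coequalizerπ ≫= s.w φ).trans (Category.comp_id _).symm) } }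
  have fac₀ (s) (k : LiftedPair p q) :
      b.ι.app k.j ≫ desc₀ s = k.coequalizerπ ≫ s.ι.app k := hb'.fac _ k
  have condition (s) : p ≫ desc₀ s = q ≫ desc₀ s := ha'.hom_ext fun k ↦ by
    change a.ι.app k.i ≫ p ≫ _ = a.ι.app k.i ≫ q ≫ _
    rw [← reassoc_of% k.hf, ← reassoc_of% k.hg, fac₀]
    exact (reassoc_of% k.coequalizerπ_condition) (s.ι.app k)
  exact
    { desc s := Cofork.IsColimit.desc hc (desc₀ s) (condition s)
      fac s k := by
        rw [← cancel_epi k.coequalizerπ, ← fac₀]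
        refine ((reassoc_of% coequalizerπ_desc c k) _).trans ?_
        exact congr(b.ι.app k.j ≫ $(Cofork.IsColimit.π_desc' hc _ (condition s)))
      uniq s m hm := by
        refine Cofork.IsColimit.hom_ext hc (hb'.hom_ext fun k ↦ ?_)
        rw [Cofork.IsColimit.π_desc' hc _ (condition s)]
        change b.ι.app k.j ≫ c.π ≫ m = b.ι.app k.j ≫ desc₀ s
        rw [fac₀, ← hm k]
        exact ((reassoc_of% coequalizerπ_desc c k) m).symm }

end Coequalizer

end LiftedPair

/-- The fork presenting an object as a quotient of a free object is a coequalizer for any adjunction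
of descent type. -/
noncomputable def isColimitCounitCofork {C : Type u} [Category.{v} C] {D : Type u'}
    [Category.{v'} D] {F : C ⥤ D} {U : D ⥤ C} (adj : F ⊣ U) [(Monad.comparison adj).Full]
    [(Monad.comparison adj).Faithful] (X : D) :
    IsColimit (Cofork.ofπ (adj.counit.app X) (adj.counit_naturality (adj.counit.app X))) := by
  have : U.Faithful :=
    inferInstanceAs (Monad.comparison adj ⋙ Monad.forget adj.toMonad).Faithful
  refine Cofork.IsColimit.mk' _ fun s ↦ ?_
  have hs : F.map (U.map (adj.counit.app X)) ≫ s.π = adj.counit.app (F.obj (U.obj X)) ≫ s.π :=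
    s.condition
  have key : F.map (adj.unit.app (U.obj X) ≫ U.map s.π) ≫ adj.counit.app s.pt = s.π := by
    simp
  have unit_π : adj.unit.app (U.obj (F.obj (U.obj X))) ≫
      U.map (F.map (U.map (adj.counit.app X))) ≫ U.map s.π = U.map s.π := by
    rw [← U.map_comp, hs, U.map_comp, adj.right_triangle_components_assoc]
  let φ : (Monad.comparison adj).obj X ⟶ (Monad.comparison adj).obj s.pt :=
    { f := adj.unit.app (U.obj X) ≫ U.map s.π
      h := by
        change U.map (F.map (adj.unit.app (U.obj X) ≫ U.map s.π)) ≫ U.map (adj.counit.app s.pt) =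
          U.map (adj.counit.app X) ≫ adj.unit.app (U.obj X) ≫ U.map s.π
        rw [← U.map_comp, key]
        exact unit_π.symm.trans (adj.unit_naturality_assoc (U.map (adj.counit.app X)) _) }
  let g : X ⟶ s.pt := (Monad.comparison adj).preimage φ
  have hg : U.map g = adj.unit.app (U.obj X) ≫ U.map s.π :=
    congr_arg Monad.Algebra.Hom.f ((Monad.comparison adj).map_preimage φ)
  have fac : adj.counit.app X ≫ g = s.π := by
    rw [← adj.counit_naturality g, hg, key]
  refine ⟨g, fac, fun {m} hm ↦ U.map_injective ?_⟩
  have hm : adj.counit.app X ≫ m = s.π := hm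
  rw [hg, ← hm, U.map_comp, adj.right_triangle_components_assoc]

lemma locallySmall_of_rootIsCardinalPresentable {C : Type u} [Category.{v} C] {κ : Cardinal.{w}}
    (hC : _root_.IsCardinalPresentable κ C) : LocallySmall.{w} C where
  hom_small X Y := by
    by_cases hU : UnivLE.{v, w}
    · infer_instance
    have : UnivLE.{w, v} := univLE_total.resolve_left hU
    obtain ⟨α, hα⟩ : ∃ α : Type v, ¬ Small.{w} α := by
      by_contra! h
      exact hU ⟨h⟩
    have hemb (J : Type w) : Nonempty (J ↪ α) := by
      rw [← Cardinal.lift_mk_le']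
      refine (le_total _ _).resolve_right fun h ↦ hα ?_
      obtain ⟨e⟩ := Cardinal.lift_mk_le'.1 h
      exact small_of_injective e.injective
    suffices Subsingleton (X ⟶ Y) from inferInstance
    refine ⟨fun f g ↦ by_contra fun hfg ↦ ?_⟩
    obtain ⟨hcolim, -, hpres, ι, G, -, hG⟩ := hC
    have hinj (P : C) : ∃ φ : (P ⟶ Y) → (α → Option (Shrink.{v} (Σ i : ι, G i ⟶ Y))),
        Function.Injective φ := by
      obtain ⟨J, F, c, ⟨hc⟩, -, hF, ⟨e⟩⟩ := hpres P
      choose i hi using fun j ↦ hG _ (hF j)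
      obtain ⟨t⟩ := hemb J
      refine ⟨fun h ↦ Function.extend t (fun j ↦ some (equivShrink _
        ⟨i j, (hi j).some.inv ≫ c.ι.app j ≫ e.hom ≫ h⟩)) (fun _ ↦ none), fun h h' hh ↦ ?_⟩
      rw [← cancel_epi e.hom]
      refine hc.hom_ext fun j ↦ ?_
      have := congr_fun hh (t j)
      simpa [t.injective.extend_apply] using this
    let T := α → Option (Shrink.{v} (Σ i : ι, G i ⟶ Y))
    obtain ⟨φ, hφ⟩ := hinj (∐ fun _ : T ↦ X)
    classical
    refine Function.cantor_injective
      (fun s : Set T ↦ φ (Limits.Sigma.desc fun x ↦ if x ∈ s then f else g)) fun s s' h ↦ ?_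
    ext x
    have := Limits.Sigma.ι (fun _ : T ↦ X) x ≫= hφ h
    simp only [colimit.ι_desc, Cofan.mk_ι_app] at this
    grind

lemma isCardinalPresentable_coequalizer {C : Type u} [Category.{v} C] (κ : Cardinal.{w})
    [Fact κ.IsRegular] {X Y : C} (f g : X ⟶ Y) [HasCoequalizer f g]
    [hX : IsCardinalPresentable X κ] [hY : IsCardinalPresentable Y κ] :
    IsCardinalPresentable (coequalizer f g) κ := by
  have (k : WalkingParallelPair) : IsCardinalPresentable ((parallelPair f g).obj k) κ := by
    cases k
    · exact hX
    · exact hY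
  exact isCardinalPresentable_of_isColimit' _ (colimit.isColimit (parallelPair f g)) κ
    (hasCardinalLT_of_finite _ _ (Fact.out : κ.IsRegular).aleph0_le)

/-- A retract is the coequalizer of the corresponding idempotent and the identity. -/
noncomputable def Retract.isoCoequalizer {C : Type u} [Category.{v} C] {X Y : C} (h : Retract X Y)
    [HasCoequalizer (h.r ≫ h.i) (𝟙 Y)] : X ≅ coequalizer (h.r ≫ h.i) (𝟙 Y) where
  hom := h.i ≫ coequalizer.π _ _
  inv := coequalizer.desc h.r (by simp)
  inv_hom_id := coequalizer.hom_ext (by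
    simpa using coequalizer.condition (h.r ≫ h.i) (𝟙 Y))

lemma exists_isColimit_of_rootIsCardinalPresentable {C : Type u} [Category.{v} C]
    {κ : Cardinal.{w}} [Fact κ.IsRegular] (hC : _root_.IsCardinalPresentable κ C) (X : C) :
    ∃ (J : Type w) (_ : SmallCategory J) (F : J ⥤ C) (t : F ⟶ (Functor.const J).obj X),
      Nonempty (IsColimit (Cocone.mk X t)) ∧ IsCardinalFiltered J κ ∧
      ∀ j, IsCardinalPresentable (F.obj j) κ := by
  obtain ⟨J, F, c, ⟨hc⟩, hJ, hF, ⟨e⟩⟩ := hC.2.2.1 X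
  exact ⟨J, inferInstance, F, (c.extend e.hom).ι, ⟨hc.extendIso e.hom⟩,
    (rootIsCardinalFiltered_iff J).1 hJ, fun j ↦ (rootIsCardinalCompact_iff _).1 (hF j)⟩

/-- For an adjunction of descent type whose right adjoint is `κ`-accessible, any object is a
`κ`-filtered colimit of coequalizers of maps between free objects on `κ`-compact objects. -/
lemma exists_isColimit_coequalizer_of_adjunction {C : Type u} [Category.{v} C] {D : Type u'}
    [Category.{v'} D] {F : C ⥤ D} {U : D ⥤ C} (adj : F ⊣ U) [(Monad.comparison adj).Full]
    [(Monad.comparison adj).Faithful] {κ : Cardinal.{w}} [Fact κ.IsRegular]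
    [U.IsCardinalAccessible κ] [HasCoequalizers D] [LocallySmall.{w} D]
    (hC : _root_.IsCardinalPresentable κ C) (X : D) :
    ∃ (K : Type w) (_ : SmallCategory K) (G : K ⥤ D) (t : G ⟶ (Functor.const K).obj X),
      Nonempty (IsColimit (Cocone.mk X t)) ∧ IsCardinalFiltered K κ ∧
      ∀ k, ∃ (x y : C) (f g : F.obj x ⟶ F.obj y), IsCardinalPresentable x κ ∧
        IsCardinalPresentable y κ ∧ Nonempty (G.obj k ≅ coequalizer f g) := by
  obtain ⟨I, _, A, a, ⟨ha⟩, _, hA⟩ :=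
    exists_isColimit_of_rootIsCardinalPresentable hC (U.obj (F.obj (U.obj X)))
  obtain ⟨J, _, B, b, ⟨hb⟩, _, hB⟩ :=
    exists_isColimit_of_rootIsCardinalPresentable hC (U.obj X)
  have := adj.leftAdjoint_preservesColimits
  have (i : I) : IsCardinalPresentable ((A ⋙ F).obj i) κ :=
    adj.isCardinalPresentable_leftAdjoint_obj κ (A.obj i)
  let a' := F.mapCocone (Cocone.mk _ a)
  let b' := F.mapCocone (Cocone.mk _ b)
  have ha' : IsColimit a' := isColimitOfPreserves F ha
  have hb' : IsColimit b' := isColimitOfPreserves F hb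
  let p : a'.pt ⟶ b'.pt := F.map (U.map (adj.counit.app X))
  let q : a'.pt ⟶ b'.pt := adj.counit.app (F.obj (U.obj X))
  have := LiftedPair.isCardinalFiltered (p := p) (q := q) κ hb'
  have := LiftedPair.final_source (p := p) (q := q) κ hb'
  have := LiftedPair.final_target (p := p) (q := q) κ hb'
  have hX := LiftedPair.isColimitCoequalizerι (p := p) (q := q) ha' hb'
    (isColimitCounitCofork adj X)
  let e := equivSmallModel.{w} (LiftedPair p q)
  let c := Cocone.mk X (LiftedPair.coequalizerι (p := p) (q := q)
    (Cofork.ofπ (adj.counit.app X) (adj.counit_naturality (adj.counit.app X))))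
  exact ⟨SmallModel.{w} (LiftedPair p q), inferInstance,
    e.inverse ⋙ LiftedPair.coequalizerFunctor p q, (c.whisker e.inverse).ι,
    ⟨(Functor.Final.isColimitWhiskerEquiv e.inverse _).symm hX⟩, .of_equivalence κ e,
    fun k ↦ ⟨_, _, (e.inverse.obj k).f, (e.inverse.obj k).g, hA _, hB _, ⟨Iso.refl _⟩⟩⟩

end CategoryTheory

theorem statement11 {C : Type u} [Category.{v} C] {D : Type u'} [Category.{v'} D]
    (F : C ⥤ D) (U : D ⥤ C) (adj : F ⊣ U)
    (hmonadic : (Monad.comparison adj).IsEquivalence)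
    (κ : Cardinal.{w}) (hκ : κ.IsRegular)
    (hC : IsCardinalPresentable κ C) (hD : HasColimits D)
    (hU : ∀ J : Cat.{w, w}, IsCardinalFiltered κ J →
      Nonempty (PreservesColimitsOfShape J U)) :
    IsCardinalPresentable κ D := by
  have : Fact κ.IsRegular := ⟨hκ⟩
  have : U.IsCardinalAccessible κ :=
    ⟨fun J _ _ ↦ (hU (Cat.of J) ((rootIsCardinalFiltered_iff _).2 ‹_›)).some⟩
  have := locallySmall_of_rootIsCardinalPresentable hC
  have : U.Faithful :=
    inferInstanceAs (Monad.comparison adj ⋙ Monad.forget adj.toMonad).Faithful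
  have : LocallySmall.{w} D := locallySmall_of_faithful U
  have : HasCoequalizers D := inferInstance
  have hF (X : C) (hX : CategoryTheory.IsCardinalPresentable X κ) :
      CategoryTheory.IsCardinalPresentable (F.obj X) κ :=
    adj.isCardinalPresentable_leftAdjoint_obj κ X
  have hpres (X : D) := exists_isColimit_coequalizer_of_adjunction adj hC X
  refine ⟨hD, fun J hJ ↦ ?_, fun X ↦ ?_, ?_⟩
  · let : MonadicRightAdjoint U := ⟨F, adj, hmonadic⟩
    have := (hU J hJ).some
    have := hC.2.1 J hJ
    have := monadicCreatesColimitsOfShapeOfPreservesColimitsOfShape (J := J) U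
    exact hasColimitsOfShape_of_hasColimitsOfShape_createsColimitsOfShape U
  · obtain ⟨K, _, G, t, ht, hK, hG⟩ := hpres X
    refine ⟨Cat.of K, G, Cocone.mk X t, ht, (rootIsCardinalFiltered_iff _).2 hK, fun k ↦ ?_,
      ⟨Iso.refl _⟩⟩
    rw [rootIsCardinalCompact_iff]
    obtain ⟨x, y, f, g, hx, hy, ⟨e⟩⟩ := hG k
    have := hF x hx
    have := hF y hy
    have := isCardinalPresentable_coequalizer κ f g
    exact isCardinalPresentable_of_iso e.symm κ
  · obtain ⟨-, -, -, ι, G, hG, hG'⟩ := hC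
    have (i : ι) : CategoryTheory.IsCardinalPresentable (F.obj (G i)) κ :=
      hF _ ((rootIsCardinalCompact_iff _).1 (hG i))
    let S := Σ (i : ι) (j : ι), Shrink.{w} (F.obj (G i) ⟶ F.obj (G j)) ×
      Shrink.{w} (F.obj (G i) ⟶ F.obj (G j))
    let E (s : S) : D := coequalizer ((equivShrink _).symm s.2.2.1) ((equivShrink _).symm s.2.2.2)
    have (s : S) : CategoryTheory.IsCardinalPresentable (E s) κ :=
      isCardinalPresentable_coequalizer κ _ _
    refine ⟨Σ s : S, Shrink.{w} (E s ⟶ E s),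
      fun s ↦ coequalizer ((equivShrink _).symm s.2) (𝟙 _), fun s ↦ ?_, fun X hX ↦ ?_⟩
    · exact (rootIsCardinalCompact_iff _).2 (isCardinalPresentable_coequalizer κ _ _)
    · rw [rootIsCardinalCompact_iff] at hX
      obtain ⟨K, _, H, t, ⟨ht⟩, _, hH⟩ := hpres X
      obtain ⟨k, l, hl⟩ := IsCardinalPresentable.exists_hom_of_isColimit κ ht (𝟙 X)
      obtain ⟨x, y, f, g, hx, hy, ⟨e⟩⟩ := hH k
      obtain ⟨i, ⟨ei⟩⟩ := hG' x ((rootIsCardinalCompact_iff _).2 hx)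
      obtain ⟨j, ⟨ej⟩⟩ := hG' y ((rootIsCardinalCompact_iff _).2 hy)
      let s : S := ⟨i, j, equivShrink _ (F.map ei.inv ≫ f ≫ F.map ej.hom),
        equivShrink _ (F.map ei.inv ≫ g ≫ F.map ej.hom)⟩
      let e' : coequalizer f g ≅ E s := HasColimit.isoOfNatIso
        (parallelPair.ext (F.mapIso ei) (F.mapIso ej) (by simp [s]) (by simp [s]))
      let r : Retract X (E s) :=
        { i := l ≫ (e ≪≫ e').hom
          r := (e ≪≫ e').inv ≫ t.app k
          retract := by simpa using hl }
      refine ⟨⟨s, equivShrink _ (r.r ≫ r.i)⟩, ⟨r.isoCoequalizer ≪≫ eqToIso ?_⟩⟩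
      simp
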